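/- Let d ≥ 1 and let L : ℝ^d → ℝ be continuous and bounded. For δ > 0 define the smoothed function L_δ(θ) := E_{w∼Unif(𝔹^d)}[L(θ + δ w)], where Unif(𝔹^d) is the uniform probability distribution on the closed unit ball of ℝ^d. Then L_δ is differentiable on ℝ^d and for every θ ∈ ℝ^d, ∇L_δ(θ) = (d/δ) · E_{u∼Unif(𝕊^{d−1})}[L(θ + δ u) u], where Unif(𝕊^{d−1}) is the uniform probability distribution on the unit sphere of ℝ^d. -/

import Mathlib

open MeasureTheory Metric

/-- The uniform probability distribution on the closed unit ball of `ℝ^d`. -/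
noncomputable def unifBall (d : ℕ) : Measure (EuclideanSpace ℝ (Fin d)) :=
  (volume (closedBall (0 : EuclideanSpace ℝ (Fin d)) 1))⁻¹ •
    volume.restrict (closedBall (0 : EuclideanSpace ℝ (Fin d)) 1)

/-- The uniform probability distribution on the unit sphere of `ℝ^d`. -/
noncomputable def unifSphere (d : ℕ) : Measure (sphere (0 : EuclideanSpace ℝ (Fin d)) 1) :=
  ((volume : Measure (EuclideanSpace ℝ (Fin d))).toSphere Set.univ)⁻¹ •
    (volume : Measure (EuclideanSpace ℝ (Fin d))).toSphere

open Set Filter Topology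

theorem integral_eq_integral_Ioi_integral_toSphere {E F : Type*} [NormedAddCommGroup E]
    [NormedSpace ℝ E] [FiniteDimensional ℝ E] [Nontrivial E] [MeasurableSpace E] [BorelSpace E]
    [NormedAddCommGroup F] [NormedSpace ℝ F] (μ : Measure E) [μ.IsAddHaarMeasure]
    {f : E → F} (hf : Integrable f μ) :
    ∫ x, f x ∂μ = ∫ r in Ioi (0 : ℝ), r ^ (Module.finrank ℝ E - 1) •
      ∫ u : sphere (0 : E) 1, f (r • (u : E)) ∂μ.toSphere := by
  have hmp := μ.measurePreserving_homeomorphUnitSphereProd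
  have hemb := (homeomorphUnitSphereProd E).measurableEmbedding
  have hpt : ∀ x : ({0}ᶜ : Set E),
      f (((homeomorphUnitSphereProd E x).2 : ℝ) • ((homeomorphUnitSphereProd E x).1 : E)) = f x := by
    intro x
    have h := congrArg Subtype.val ((homeomorphUnitSphereProd E).symm_apply_apply x)
    rw [homeomorphUnitSphereProd_symm_apply_coe] at h
    rw [h]
  have hint : Integrable (fun p : sphere (0 : E) 1 × Ioi (0 : ℝ) ↦ f ((p.2 : ℝ) • (p.1 : E)))
      (μ.toSphere.prod (.volumeIoiPow (Module.finrank ℝ E - 1))) := by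
    rw [← hmp.integrable_comp_emb hemb]
    simp only [Function.comp_def, hpt]
    exact (integrableOn_iff_comap_subtypeVal (measurableSet_singleton _).compl).1 hf.integrableOn
  calc
    ∫ x, f x ∂μ = ∫ x : ({0}ᶜ : Set E), f x ∂(μ.comap (↑)) := by
      rw [integral_subtype_comap (measurableSet_singleton _).compl f, restrict_compl_singleton]
    _ = ∫ p : sphere (0 : E) 1 × Ioi (0 : ℝ), f ((p.2 : ℝ) • (p.1 : E))
          ∂(μ.toSphere.prod (.volumeIoiPow (Module.finrank ℝ E - 1))) := by
      rw [← hmp.integral_comp hemb]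
      simp only [hpt]
    _ = ∫ r : Ioi (0 : ℝ), (∫ u : sphere (0 : E) 1, f ((r : ℝ) • (u : E)) ∂μ.toSphere)
          ∂(.volumeIoiPow (Module.finrank ℝ E - 1)) := integral_prod_symm _ hint
    _ = _ := by
      simp only [Measure.volumeIoiPow, ENNReal.ofReal]
      rw [integral_withDensity_eq_integral_smul (by fun_prop),
        ← integral_subtype_comap measurableSet_Ioi fun r : ℝ ↦ r ^ (Module.finrank ℝ E - 1) •
          ∫ u : sphere (0 : E) 1, f (r • (u : E)) ∂μ.toSphere]
      refine integral_congr_ae (.of_forall fun r ↦ ?_)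
      have hr : (0 : ℝ) ≤ r := r.2.out.le
      simp [NNReal.smul_def, Real.coe_toNNReal _ (pow_nonneg hr _)]

section Cutoff

/-- A smooth cutoff equal to `1` on `s ≤ 1` and to `0` on `1 + 1 / (n + 1) ≤ s`. -/
noncomputable def ballCutoff (n : ℕ) (s : ℝ) : ℝ := Real.smoothTransition (1 - (n + 1) * (s - 1))

theorem contDiff_ballCutoff (n : ℕ) : ContDiff ℝ 1 (ballCutoff n) := by
  have : ContDiff ℝ 1 Real.smoothTransition := Real.smoothTransition.contDiff (n := 1)
  unfold ballCutoff
  fun_prop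

theorem antitone_ballCutoff (n : ℕ) : Antitone (ballCutoff n) := fun s t hst ↦
  Real.smoothTransition.monotone (by gcongr)

theorem ballCutoff_of_le_one (n : ℕ) {s : ℝ} (hs : s ≤ 1) : ballCutoff n s = 1 :=
  Real.smoothTransition.one_of_one_le (by nlinarith [(n.cast_nonneg : (0 : ℝ) ≤ n)])

theorem ballCutoff_of_ge (n : ℕ) {s : ℝ} (hs : 1 + 1 / ((n : ℝ) + 1) ≤ s) :
    ballCutoff n s = 0 := by
  refine Real.smoothTransition.zero_of_nonpos ?_
  have hn : (0 : ℝ) < n + 1 := by positivity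
  have : 1 / ((n : ℝ) + 1) ≤ s - 1 := by linarith
  rw [div_le_iff₀ hn] at this
  linarith

theorem deriv_ballCutoff_of_lt_one (n : ℕ) {s : ℝ} (hs : s < 1) : deriv (ballCutoff n) s = 0 := by
  have : ballCutoff n =ᶠ[𝓝 s] fun _ ↦ 1 := by
    filter_upwards [Iio_mem_nhds hs] with t ht using ballCutoff_of_le_one n (le_of_lt ht)
  rw [this.deriv_eq, deriv_const]

theorem deriv_ballCutoff_of_gt (n : ℕ) {s : ℝ} (hs : 1 + 1 / ((n : ℝ) + 1) < s) :
    deriv (ballCutoff n) s = 0 := by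
  have : ballCutoff n =ᶠ[𝓝 s] fun _ ↦ 0 := by
    filter_upwards [Ioi_mem_nhds hs] with t ht using ballCutoff_of_ge n (le_of_lt ht)
  rw [this.deriv_eq, deriv_const]

theorem one_div_natCast_add_one_le_one (n : ℕ) : 1 / ((n : ℝ) + 1) ≤ 1 := by
  rw [div_le_one (by positivity)]
  linarith [(n.cast_nonneg : (0 : ℝ) ≤ n)]

/-- The radial density `r ↦ -d/dr (ballCutoff n (r ^ 2))`, which concentrates at `r = 1`. -/
noncomputable def radialKernel (n : ℕ) (r : ℝ) : ℝ := -(2 * deriv (ballCutoff n) (r ^ 2) * r)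

theorem continuous_radialKernel (n : ℕ) : Continuous (radialKernel n) := by
  have : Continuous (deriv (ballCutoff n)) := (contDiff_ballCutoff n).continuous_deriv le_rfl
  unfold radialKernel
  fun_prop

theorem radialKernel_nonneg (n : ℕ) {r : ℝ} (hr : 0 ≤ r) : 0 ≤ radialKernel n r := by
  have : deriv (ballCutoff n) (r ^ 2) ≤ 0 := (antitone_ballCutoff n).deriv_nonpos
  unfold radialKernel
  nlinarith

theorem radialKernel_eq_zero (n : ℕ) {r : ℝ} (hr : 0 ≤ r)
    (h : r ∉ Icc 1 (1 + 1 / ((n : ℝ) + 1))) : radialKernel n r = 0 := by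
  have hn : 0 < 1 / ((n : ℝ) + 1) := by positivity
  suffices deriv (ballCutoff n) (r ^ 2) = 0 by simp [radialKernel, this]
  rcases lt_or_ge r 1 with h1 | h1
  · exact deriv_ballCutoff_of_lt_one n (by nlinarith)
  · have : 1 + 1 / ((n : ℝ) + 1) < r := by
      by_contra! h2
      exact h ⟨h1, h2⟩
    exact deriv_ballCutoff_of_gt n (by nlinarith)

theorem hasCompactSupport_radialKernel (n : ℕ) : HasCompactSupport (radialKernel n) := by
  refine HasCompactSupport.intro (isCompact_Icc (a := (-2 : ℝ)) (b := 2)) fun r hr ↦ ?_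
  have h2 : 4 < r ^ 2 := by
    by_contra! h
    exact hr ⟨by nlinarith, by nlinarith⟩
  have := one_div_natCast_add_one_le_one n
  simp [radialKernel, deriv_ballCutoff_of_gt n (s := r ^ 2) (by linarith)]

theorem integral_radialKernel (n : ℕ) : ∫ r in Ioi (0 : ℝ), radialKernel n r = 1 := by
  have hd : ∀ r ∈ Ici (0 : ℝ), HasDerivAt (fun r ↦ -ballCutoff n (r ^ 2)) (radialKernel n r) r := by
    intro r _
    have h := (((contDiff_ballCutoff n).differentiable one_ne_zero) (r ^ 2)).hasDerivAt.comp r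
      (hasDerivAt_pow 2 r)
    refine h.neg.congr_deriv ?_
    simp only [radialKernel]
    push_cast
    ring
  have hlim : Tendsto (fun r : ℝ ↦ -ballCutoff n (r ^ 2)) atTop (𝓝 0) := by
    refine tendsto_const_nhds.congr' ?_
    filter_upwards [eventually_ge_atTop 2] with r hr
    have := one_div_natCast_add_one_le_one n
    rw [ballCutoff_of_ge n (by nlinarith), neg_zero]
  rw [integral_Ioi_of_hasDerivAt_of_nonneg' hd
    (fun r hr ↦ radialKernel_nonneg n (le_of_lt hr)) hlim]
  simp [ballCutoff_of_le_one]

end Cutoff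

section Ball

variable {E : Type*} [NormedAddCommGroup E] [InnerProductSpace ℝ E] [FiniteDimensional ℝ E]
  [MeasurableSpace E] [BorelSpace E]

theorem hasFDerivAt_integral_mul_ballCutoff {μ : Measure E} [μ.IsAddHaarMeasure] {L : E → ℝ}
    (hL : Continuous L) (n : ℕ) (θ : E) :
    HasFDerivAt (fun θ ↦ ∫ w, L (θ + w) * ballCutoff n (‖w‖ ^ 2) ∂μ)
      (∫ w, (-(2 * deriv (ballCutoff n) (‖w‖ ^ 2)) * L (θ + w)) • innerSL ℝ w ∂μ) θ := by
  set K : E → ℝ := fun w ↦ ballCutoff n (‖w‖ ^ 2) with hK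
  have hKd : ContDiff ℝ 1 K := (contDiff_ballCutoff n).comp (contDiff_norm_sq ℝ)
  have hKs : HasCompactSupport K := by
    refine HasCompactSupport.intro (isCompact_closedBall (0 : E) 2) fun w hw ↦ ?_
    have hw : 2 < ‖w‖ := by simpa using hw
    have := one_div_natCast_add_one_le_one n
    exact ballCutoff_of_ge n (by nlinarith)
  have hK' : ∀ w, HasFDerivAt K ((2 * deriv (ballCutoff n) (‖w‖ ^ 2)) • innerSL ℝ w) w := by
    intro w
    have h := (((contDiff_ballCutoff n).differentiable one_ne_zero)
      (‖w‖ ^ 2)).hasDerivAt.comp_hasFDerivAt w (hasStrictFDerivAt_norm_sq w).hasFDerivAt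
    refine h.congr_fderiv ?_
    ext v
    simp
    ring
  have key := hKs.hasFDerivAt_convolution_right (μ := μ) (ContinuousLinearMap.mul ℝ ℝ)
    hL.locallyIntegrable hKd θ
  have hfun : (fun θ ↦ ∫ w, L (θ + w) * ballCutoff n (‖w‖ ^ 2) ∂μ) =
      convolution L K (ContinuousLinearMap.mul ℝ ℝ) μ := by
    ext θ
    rw [convolution_def,
      ← integral_add_left_eq_self (fun t ↦ ContinuousLinearMap.mul ℝ ℝ (L t) (K (θ - t))) θ]
    simp [hK]
  rw [hfun]
  refine key.congr_fderiv ?_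
  rw [convolution_def, ← integral_add_left_eq_self _ θ]
  congr 1
  ext w v
  simp [(hK' _).fderiv, ContinuousLinearMap.precompR_apply]
  ring

theorem continuous_integral_toSphere (μ : Measure E) [μ.IsAddHaarMeasure] {L : E → ℝ}
    (hL : Continuous L) :
    Continuous fun p : E × ℝ ↦ ∫ u : sphere (0 : E) 1,
      L (p.1 + p.2 • (u : E)) • innerSL ℝ (u : E) ∂μ.toSphere := by
  have h := continuous_parametric_integral_of_continuous (μ := μ.toSphere)
    (f := fun (p : E × ℝ) (u : sphere (0 : E) 1) ↦
      L (p.1 + p.2 • (u : E)) • innerSL ℝ (u : E)) (by unfold Function.uncurry; fun_prop)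
      (s := univ) isCompact_univ
  simpa using h

theorem tendsto_integral_mul_ballCutoff (μ : Measure E) [μ.IsAddHaarMeasure] {L : E → ℝ}
    (hL : Continuous L) (θ : E) :
    Tendsto (fun n ↦ ∫ w, L (θ + w) * ballCutoff n (‖w‖ ^ 2) ∂μ) atTop
      (𝓝 (∫ w in closedBall 0 1, L (θ + w) ∂μ)) := by
  rw [← integral_indicator measurableSet_closedBall]
  refine tendsto_integral_of_dominated_convergence
    ((closedBall (0 : E) 2).indicator fun w ↦ ‖L (θ + w)‖) (fun n ↦ ?_) ?_ (fun n ↦ ?_) ?_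
  · have := (contDiff_ballCutoff n).continuous
    exact Continuous.aestronglyMeasurable (by fun_prop)
  · rw [integrable_indicator_iff measurableSet_closedBall]
    exact ContinuousOn.integrableOn_compact (isCompact_closedBall _ _)
      (by fun_prop)
  · refine .of_forall fun w ↦ ?_
    by_cases hw : w ∈ closedBall (0 : E) 2
    · rw [indicator_of_mem hw, norm_mul]
      refine mul_le_of_le_one_right (norm_nonneg _) ?_
      rw [ballCutoff, Real.norm_of_nonneg (Real.smoothTransition.nonneg _)]
      exact Real.smoothTransition.le_one _
    · rw [indicator_of_notMem hw]
      have hw : 2 < ‖w‖ := by simpa using hw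
      have := one_div_natCast_add_one_le_one n
      simp [ballCutoff_of_ge n (s := ‖w‖ ^ 2) (by nlinarith)]
  · refine .of_forall fun w ↦ tendsto_const_nhds.congr' ?_
    by_cases hw : w ∈ closedBall (0 : E) 1
    · have hw1 : ‖w‖ ≤ 1 := by simpa using hw
      refine .of_forall fun n ↦ ?_
      simp only
      rw [indicator_of_mem hw, ballCutoff_of_le_one n (by nlinarith [norm_nonneg w]), mul_one]
    · have hw1 : 1 < ‖w‖ := by simpa using hw
      filter_upwards [(tendsto_one_div_add_atTop_nhds_zero_nat (𝕜 := ℝ)).eventually_lt_const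
        (sub_pos.2 hw1)] with n hn
      rw [indicator_of_notMem hw, ballCutoff_of_ge n (by nlinarith), mul_zero]

variable [Nontrivial E]

theorem integral_deriv_ballCutoff_smul_innerSL (μ : Measure E) [μ.IsAddHaarMeasure] {L : E → ℝ}
    (hL : Continuous L) (n : ℕ) (θ : E) :
    ∫ w, (-(2 * deriv (ballCutoff n) (‖w‖ ^ 2)) * L (θ + w)) • innerSL ℝ w ∂μ =
      ∫ r in Ioi (0 : ℝ), radialKernel n r • r ^ (Module.finrank ℝ E - 1) •
        ∫ u : sphere (0 : E) 1, L (θ + r • (u : E)) • innerSL ℝ (u : E) ∂μ.toSphere := by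
  have hc : Continuous (deriv (ballCutoff n)) := (contDiff_ballCutoff n).continuous_deriv le_rfl
  rw [integral_eq_integral_Ioi_integral_toSphere μ]
  · refine setIntegral_congr_fun measurableSet_Ioi fun r hr ↦ ?_
    have hr : 0 < r := hr
    rw [smul_comm]
    congr 1
    rw [← integral_smul]
    congr 1
    ext u v
    simp [radialKernel, norm_smul, abs_of_pos hr]
    ring
  · refine Continuous.integrable_of_hasCompactSupport (by fun_prop) ?_
    refine HasCompactSupport.intro (isCompact_closedBall (0 : E) 2) fun w hw ↦ ?_
    have hw : 2 < ‖w‖ := by simpa using hw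
    have := one_div_natCast_add_one_le_one n
    simp [deriv_ballCutoff_of_gt n (s := ‖w‖ ^ 2) (by nlinarith)]

theorem hasFDerivAt_integral_closedBall (μ : Measure E) [μ.IsAddHaarMeasure] {L : E → ℝ}
    (hL : Continuous L) (θ : E) :
    HasFDerivAt (fun θ ↦ ∫ w in closedBall 0 1, L (θ + w) ∂μ)
      (∫ u : sphere (0 : E) 1, L (θ + u) • innerSL ℝ (u : E) ∂μ.toSphere) θ := by
  set H : E × ℝ → E →L[ℝ] ℝ := fun p ↦ p.2 ^ (Module.finrank ℝ E - 1) •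
    ∫ u : sphere (0 : E) 1, L (p.1 + p.2 • (u : E)) • innerSL ℝ (u : E) ∂μ.toSphere with hH
  have hHc : Continuous H := (continuous_snd.pow _).smul (continuous_integral_toSphere μ hL)
  have hlim : TendstoUniformlyOnFilter
      (fun n θ ↦ ∫ r in Ioi (0 : ℝ), radialKernel n r • H (θ, r)) (fun θ ↦ H (θ, 1))
      atTop (𝓝 θ) := by
    rw [Metric.tendstoUniformlyOnFilter_iff]
    intro ε hε
    have hnear : ∀ᶠ p in 𝓝 θ ×ˢ 𝓝 (1 : ℝ), dist (H p) (H (θ, 1)) < ε / 4 := by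
      rw [← nhds_prod_eq]
      exact hHc.continuousAt.eventually (ball_mem_nhds _ (by positivity))
    obtain ⟨P, hP, Q, hQ, hPQ⟩ := eventually_prod_iff.1 hnear
    obtain ⟨η, hη, hηQ⟩ := Metric.eventually_nhds_iff.1 hQ
    have hn := (tendsto_one_div_add_atTop_nhds_zero_nat (𝕜 := ℝ)).eventually_lt_const hη
    filter_upwards [hn.prod_mk hP] with ⟨n, x⟩ ⟨hn, hx⟩
    have hκ := (continuous_radialKernel n).integrable_of_hasCompactSupport (μ := volume)
      (hasCompactSupport_radialKernel n)
    have hκH : Integrable (fun r ↦ radialKernel n r • H (x, r)) :=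
      ((continuous_radialKernel n).smul (by fun_prop)).integrable_of_hasCompactSupport
        (hasCompactSupport_radialKernel n).smul_right
    have hconst : H (x, 1) = ∫ r in Ioi (0 : ℝ), radialKernel n r • H (x, 1) := by
      rw [integral_smul_const, integral_radialKernel, one_smul]
    rw [hconst, dist_comm, dist_eq_norm, ← integral_sub hκH.integrableOn
      (hκ.smul_const _).integrableOn]
    calc
      _ ≤ ∫ r in Ioi (0 : ℝ), radialKernel n r * (ε / 2) := by
        refine norm_integral_le_of_norm_le (hκ.mul_const _).integrableOn
          ((ae_restrict_mem measurableSet_Ioi).mono fun r hr ↦ ?_)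
        have hr : 0 < r := hr
        change ‖radialKernel n r • H (x, r) - radialKernel n r • H (x, 1)‖ ≤ _
        rw [← smul_sub (radialKernel n r) (H (x, r)) (H (x, 1)), norm_smul, Real.norm_of_nonneg (radialKernel_nonneg n hr.le)]
        by_cases h : r ∈ Icc 1 (1 + 1 / ((n : ℝ) + 1))
        · refine mul_le_mul_of_nonneg_left ?_ (radialKernel_nonneg n hr.le)
          have h1 := hPQ hx (hηQ (y := r) (by
            rw [Real.dist_eq, abs_of_nonneg (by linarith [h.1])]; linarith [h.2]))
          have h2 := hPQ hx (hηQ (y := 1) (by simpa using hη))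
          rw [← dist_eq_norm]
          linarith [dist_triangle_right (H (x, r)) (H (x, 1)) (H (θ, 1))]
        · simp [radialKernel_eq_zero n hr.le h]
      _ = ε / 2 := by rw [integral_mul_const, integral_radialKernel, one_mul]
      _ < ε := by linarith
  have h := hasFDerivAt_of_tendstoUniformlyOnFilter hlim
    (f := fun n θ ↦ ∫ w, L (θ + w) * ballCutoff n (‖w‖ ^ 2) ∂μ)
    (.of_forall fun p ↦ by
      have := hasFDerivAt_integral_mul_ballCutoff (μ := μ) hL p.1 p.2
      rwa [integral_deriv_ballCutoff_smul_innerSL μ hL] at this)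
    (.of_forall (tendsto_integral_mul_ballCutoff μ hL))
  simpa [hH] using h

theorem hasGradientAt_integral_closedBall (μ : Measure E) [μ.IsAddHaarMeasure] {L : E → ℝ}
    (hL : Continuous L) {δ : ℝ} (hδ : δ ≠ 0) (θ : E) :
    HasGradientAt (fun θ ↦ ∫ w in closedBall 0 1, L (θ + δ • w) ∂μ)
      (δ⁻¹ • ∫ u : sphere (0 : E) 1, L (θ + δ • (u : E)) • (u : E) ∂μ.toSphere) θ := by
  have h := (hasFDerivAt_integral_closedBall μ (L := fun x ↦ L (δ • x)) (by fun_prop)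
    (δ⁻¹ • θ)).comp θ ((hasFDerivAt_id θ).const_smul δ⁻¹)
  rw [hasGradientAt_iff_hasFDerivAt]
  have hfun : (fun θ ↦ ∫ w in closedBall 0 1, L (θ + δ • w) ∂μ) =
      (fun θ ↦ ∫ w in closedBall 0 1, L (δ • (θ + w)) ∂μ) ∘ fun θ ↦ δ⁻¹ • θ := by
    ext θ
    simp [smul_add, smul_smul, hδ]
  rw [hfun]
  refine h.congr_fderiv (Eq.symm ?_)
  have hi : ∀ f : sphere (0 : E) 1 → ℝ, Continuous f →
      InnerProductSpace.toDual ℝ E (∫ u, f u • (u : E) ∂μ.toSphere) =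
        ∫ u, f u • innerSL ℝ (u : E) ∂μ.toSphere := by
    intro f hf
    have hint : Integrable (fun u : sphere (0 : E) 1 ↦ f u • (u : E)) μ.toSphere :=
      Continuous.integrable_of_hasCompactSupport (by fun_prop) (.of_compactSpace _)
    have := (innerSL ℝ (E := E)).integral_comp_comm hint
    simp only [map_smul] at this
    rw [this]
    rfl
  ext v
  rw [map_smul, hi _ (by fun_prop)]
  simp [smul_add, smul_smul, hδ]

end Ball

/-- for continuous bounded `L`, the ball-smoothed function
`L_δ(θ) = E_{w ∼ Unif(𝔹^d)}[L(θ + δw)]` is differentiable with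
`∇L_δ(θ) = (d/δ) E_{u ∼ Unif(𝕊^{d-1})}[L(θ + δu) u]`. -/
theorem stmt0 (d : ℕ) (hd : 1 ≤ d) (L : EuclideanSpace ℝ (Fin d) → ℝ)
    (hLcont : Continuous L) (hLbdd : ∃ C : ℝ, ∀ θ, |L θ| ≤ C) (δ : ℝ) (hδ : 0 < δ) :
    Differentiable ℝ (fun θ : EuclideanSpace ℝ (Fin d) => ∫ w, L (θ + δ • w) ∂(unifBall d)) ∧
    ∀ θ : EuclideanSpace ℝ (Fin d),
      gradient (fun θ' : EuclideanSpace ℝ (Fin d) => ∫ w, L (θ' + δ • w) ∂(unifBall d)) θ =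
        ((d : ℝ) / δ) •
          ∫ u : sphere (0 : EuclideanSpace ℝ (Fin d)) 1,
            L (θ + δ • (u : EuclideanSpace ℝ (Fin d))) • (u : EuclideanSpace ℝ (Fin d))
            ∂(unifSphere d) := by
  have : Nontrivial (EuclideanSpace ℝ (Fin d)) := by
    have : Nonempty (Fin d) := ⟨⟨0, hd⟩⟩
    infer_instance
  set B : ℝ := volume.real (closedBall (0 : EuclideanSpace ℝ (Fin d)) 1) with hB
  have hsphere : ((volume : Measure (EuclideanSpace ℝ (Fin d))).toSphere Set.univ).toReal =
      d * B := by
    rw [← measureReal_def, Measure.toSphere_real_apply_univ, finrank_euclideanSpace_fin, hB,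
      measureReal_def, measureReal_def, Measure.addHaar_closedBall_eq_addHaar_ball]
  have hd0 : (d : ℝ) ≠ 0 := by positivity
  have hgrad : ∀ θ : EuclideanSpace ℝ (Fin d),
      HasGradientAt (fun θ' ↦ ∫ w, L (θ' + δ • w) ∂(unifBall d))
        (((d : ℝ) / δ) • ∫ u : sphere (0 : EuclideanSpace ℝ (Fin d)) 1,
          L (θ + δ • (u : EuclideanSpace ℝ (Fin d))) • (u : EuclideanSpace ℝ (Fin d))
          ∂(unifSphere d)) θ := by
    intro θ
    have h := (hasGradientAt_integral_closedBall volume hLcont hδ.ne'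
      θ).hasFDerivAt.const_smul B⁻¹
    rw [hasGradientAt_iff_hasFDerivAt]
    simp only [unifBall, unifSphere, integral_smul_measure, ENNReal.toReal_inv, hsphere]
    refine h.congr_fderiv ?_
    rw [← map_smul, smul_smul, smul_smul]
    congr 2
    field_simp
  exact ⟨fun θ ↦ (hgrad θ).differentiableAt, fun θ ↦ (hgrad θ).gradient⟩
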